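/- Let f ∈ ℚ[x] be an irreducible polynomial of prime degree p with p > 23. If f has exactly 8 non-real complex roots, then the Galois group of f over ℚ is isomorphic to the alternating group A_p or to the symmetric group S_p. -/

import Mathlib

open Polynomial

section PrimeField

variable {p : ℕ} [Fact p.Prime]

/-- A nonempty set of nonzero elements of `ZMod p` has a nonvanishing power sum whose exponent is
positive and at most the size of the set. -/
theorem exists_sum_pow_ne_zero (U : Finset (ZMod p)) (h0 : 0 ∉ U) (hU : U.Nonempty) :
    ∃ r, 0 < r ∧ r ≤ U.card ∧ ∑ u ∈ U, u ^ r ≠ 0 := by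
  by_contra! H
  have hcard : (U.card : ZMod p) ≠ 0 := by
    intro h
    have h1 := (ZMod.natCast_eq_zero_iff _ _).1 h
    have h2 : U.card < p := by
      have := Finset.card_lt_univ_of_notMem h0
      rwa [ZMod.card] at this
    exact absurd (Nat.le_of_dvd hU.card_pos h1) (by omega)
  let q : (ZMod p)[X] := ∏ u ∈ U, (X - C u)
  have hdeg : q.natDegree = U.card := by
    simp [q, natDegree_prod_of_monic U (fun u => X - C u) fun u _ => monic_X_sub_C u]
  have hsum : ∑ u ∈ U, q.eval u = 0 := by
    refine Finset.sum_eq_zero fun u hu => ?_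
    simp only [q, eval_prod]
    exact Finset.prod_eq_zero hu (by simp)
  have hc : q.coeff 0 ≠ 0 := by
    rw [coeff_zero_eq_eval_zero]
    simp only [q, eval_prod, Finset.prod_ne_zero_iff]
    intro u hu
    have : u ≠ 0 := fun h => h0 (h ▸ hu)
    simpa using this
  simp only [eval_eq_sum_range] at hsum
  rw [Finset.sum_comm, Finset.sum_eq_single_of_mem 0 (by simp)] at hsum
  · simp [hc, hcard] at hsum
  · intro k hk hk0
    rw [← Finset.mul_sum, H k (Nat.pos_of_ne_zero hk0), mul_zero]
    rw [hdeg] at hk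
    simpa [Nat.lt_succ_iff] using hk

/-- A proper nonempty subset of the nonzero elements of `ZMod p` has a first nonvanishing power sum
with positive exponent, and this exponent is at most `(p - 1) / 2`. -/
theorem exists_first_sum_pow_ne_zero (U : Finset (ZMod p)) (h0 : 0 ∉ U) (hU : U.Nonempty)
    (hU' : ∃ v, v ≠ 0 ∧ v ∉ U) :
    ∃ r, 0 < r ∧ 2 * r < p ∧ ∑ u ∈ U, u ^ r ≠ 0 ∧
      ∀ k, 0 < k → k < r → ∑ u ∈ U, u ^ k = 0 := by
  classical
  have hp : 0 < p := (Fact.out : p.Prime).pos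
  have key : ∃ r, 0 < r ∧ 2 * r < p ∧ ∑ u ∈ U, u ^ r ≠ 0 := by
    let V : Finset (ZMod p) := (insert 0 U)ᶜ
    have hcard : U.card + V.card + 1 = p := by
      have h1 : (insert 0 U).card + V.card = p := by
        rw [Finset.card_add_card_compl, ZMod.card]
      rw [Finset.card_insert_of_notMem h0] at h1
      omega
    obtain ⟨v, hv0, hv⟩ := hU'
    have hVne : V.Nonempty := ⟨v, by simp [V, hv0, hv]⟩
    rcases le_total U.card V.card with hle | hle
    · obtain ⟨r, hr, hr', hs⟩ := exists_sum_pow_ne_zero U h0 hU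
      exact ⟨r, hr, by omega, hs⟩
    · obtain ⟨r, hr, hr', hs⟩ := exists_sum_pow_ne_zero V (by simp [V]) hVne
      refine ⟨r, hr, by omega, fun h => hs ?_⟩
      have hU1 := hU.card_pos
      have h2 : ∑ x : ZMod p, x ^ r = 0 :=
        FiniteField.sum_pow_lt_card_sub_one (K := ZMod p) r (by rw [ZMod.card]; omega)
      rw [← Finset.sum_add_sum_compl (insert 0 U), Finset.sum_insert h0, h,
        zero_pow hr.ne'] at h2
      simpa [V] using h2
  have hs := Nat.find_spec key
  refine ⟨Nat.find key, hs.1, hs.2.1, hs.2.2, fun k hk hlt => ?_⟩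
  by_contra hne
  exact Nat.find_min key hlt ⟨hk, by omega, hne⟩

/-- If averaging over the translates by `-U` fixes `h`, then the low power moments of `h` vanish. -/
theorem sum_mul_pow_eq_zero_of_average (U : Finset (ZMod p)) {r : ℕ} (hr : 0 < r)
    (hne : ∑ u ∈ U, u ^ r ≠ 0) (hmin : ∀ k, 0 < k → k < r → ∑ u ∈ U, u ^ k = 0)
    (h : ZMod p → ZMod p) (hh : ∀ x, ∑ u ∈ U, h (x - u) = U.card * h x) (j : ℕ)
    (hj : j + r < p) : ∑ x, h x * x ^ j = 0 := by
  induction j using Nat.strong_induction_on with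
  | _ j ih =>
  have h1 : ∑ x, (∑ u ∈ U, h (x - u)) * x ^ (j + r) =
      ∑ i ∈ Finset.range (j + r + 1),
        (∑ x, h x * x ^ i) * (∑ u ∈ U, u ^ (j + r - i)) * ((j + r).choose i : ZMod p) := by
    calc ∑ x, (∑ u ∈ U, h (x - u)) * x ^ (j + r)
        = ∑ u ∈ U, ∑ x, h (x - u) * x ^ (j + r) := by
          simp only [Finset.sum_mul]
          rw [Finset.sum_comm]
      _ = ∑ u ∈ U, ∑ y, h y * (y + u) ^ (j + r) := by
          refine Finset.sum_congr rfl fun u _ => ?_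
          exact Fintype.sum_equiv (Equiv.subRight u) _ _ fun x => by simp
      _ = _ := by
          simp only [add_pow, Finset.mul_sum, Finset.sum_mul]
          rw [Finset.sum_congr rfl fun u _ => Finset.sum_comm, Finset.sum_comm]
          refine Finset.sum_congr rfl fun i _ => Finset.sum_congr rfl fun u _ =>
            Finset.sum_congr rfl fun x _ => by ring
  rw [Finset.sum_range_succ, Finset.sum_eq_single_of_mem j (by simp; omega)] at h1
  · simp only [hh, Nat.add_sub_cancel_left, Nat.sub_self, pow_zero, Finset.sum_const,
      nsmul_eq_mul, mul_one, Nat.choose_self, Nat.cast_one] at h1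
    have h2 : ∑ x, (U.card : ZMod p) * h x * x ^ (j + r) =
        (∑ x, h x * x ^ (j + r)) * U.card := by
      rw [Finset.sum_mul]
      exact Finset.sum_congr rfl fun x _ => by ring
    rw [h2, right_eq_add, mul_eq_zero, mul_eq_zero] at h1
    rcases h1 with (h1 | h1) | h1
    · exact h1
    · exact absurd h1 hne
    · rw [ZMod.natCast_eq_zero_iff] at h1
      have hp : p.Prime := Fact.out
      have := (hp.dvd_factorial).1 (h1.trans ⟨j.factorial * r.factorial, by
        rw [← Nat.add_choose_mul_factorial_mul_factorial j r, Nat.choose_symm_add]; ring⟩)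
      omega
  · intro i hi hij
    rcases lt_or_gt_of_ne hij with hlt | hgt
    · rw [ih i hlt (by omega)]; simp
    · have := Finset.mem_range.1 hi
      rw [hmin (j + r - i) (by omega) (by omega)]; simp

/-- A function on a field which is supported on `S` and orthogonal to all monomials of degree less
than `#S` is zero. -/
theorem eq_zero_of_sum_mul_pow_eq_zero {K : Type*} [Field K] [Fintype K] (S : Finset K) (h : K → K)
    (hS : ∀ x ∉ S, h x = 0) (hm : ∀ j < S.card, ∑ x, h x * x ^ j = 0) (s : K) : h s = 0 := by
  classical
  by_cases hs : s ∈ S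
  swap
  · exact hS s hs
  let q : K[X] := ∏ u ∈ S.erase s, (X - C u)
  have hdeg : q.natDegree = S.card - 1 := by
    simp [q, natDegree_prod_of_monic (S.erase s) (fun u => X - C u) fun u _ => monic_X_sub_C u, hs]
  have hpos : 0 < S.card := Finset.card_pos.2 ⟨s, hs⟩
  have h1 : ∑ x, h x * q.eval x = 0 := by
    simp only [eval_eq_sum_range, Finset.mul_sum]
    rw [Finset.sum_comm]
    refine Finset.sum_eq_zero fun i hi => ?_
    rw [hdeg, Finset.mem_range] at hi
    rw [← mul_zero (q.coeff i), ← hm i (by omega), Finset.mul_sum]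
    exact Finset.sum_congr rfl fun x _ => by ring
  rw [Finset.sum_eq_single s] at h1
  · refine (mul_eq_zero.1 h1).resolve_right ?_
    simp only [q, eval_prod, Finset.prod_ne_zero_iff]
    intro u hu
    simpa [sub_eq_zero] using (Finset.ne_of_mem_erase hu).symm
  · intro x _ hx
    by_cases hxS : x ∈ S
    · have : q.eval x = 0 := by
        simp only [q, eval_prod]
        exact Finset.prod_eq_zero (Finset.mem_erase.2 ⟨hx, hxS⟩) (by simp)
      rw [this, mul_zero]
    · rw [hS x hxS, zero_mul]
  · simp

/-- A permutation of `ZMod p` which preserves a nontrivial translation-invariant relation and fixes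
about half of the points is the identity. -/
theorem perm_eq_one_of_preserves_differences (U : Finset (ZMod p)) (h0 : 0 ∉ U) (hU : U.Nonempty)
    (hU' : ∃ v, v ≠ 0 ∧ v ∉ U) (π : Equiv.Perm (ZMod p))
    (hπ : ∀ x y, y - x ∈ U ↔ π y - π x ∈ U) (hsupp : 2 * π.support.card ≤ p + 1) : π = 1 := by
  obtain ⟨r, hr, hrp, hne, hmin⟩ := exists_first_sum_pow_ne_zero U h0 hU hU'
  have hh : ∀ x, ∑ u ∈ U, (π (x - u) - (x - u)) = U.card * (π x - x) := by
    intro x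
    have h1 : ∑ u ∈ U, π (x - u) = ∑ u ∈ U, (π x - u) := by
      refine Finset.sum_bij (fun u _ => π x - π (x - u)) ?_ ?_ ?_ ?_
      · intro u hu
        exact (hπ _ _).1 (by simpa using hu)
      · intro u _ v _ huv
        simpa using huv
      · intro v hv
        refine ⟨x - π.symm (π x - v), (hπ _ _).2 (by simpa using hv), by simp⟩
      · intro u _
        simp
    rw [Finset.sum_sub_distrib, h1, ← Finset.sum_sub_distrib]
    simp [mul_sub]
  ext1 s
  refine sub_eq_zero.1 (eq_zero_of_sum_mul_pow_eq_zero π.support (fun x => π x - x) ?_ ?_ s)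
  · intro x hx
    simpa [sub_eq_zero] using hx
  · intro j hj
    exact sum_mul_pow_eq_zero_of_average U hr hne hmin _ hh j (by omega)

end PrimeField

section Counting

/-- Double counting of the incidences `F g a ∈ Q`. -/
theorem sum_card_filter_apply_mem {ι A B : Type*} [DecidableEq B] (S : Finset ι) (P : Finset A)
    (Q : Finset B) (F : ι → A → B) :
    ∑ g ∈ S, (P.filter fun a => F g a ∈ Q).card =
      ∑ a ∈ P, ∑ b ∈ Q, (S.filter fun g => F g a = b).card := by
  simp only [Finset.card_filter]
  rw [Finset.sum_comm]
  refine Finset.sum_congr rfl fun a _ => ?_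
  rw [Finset.sum_comm]
  exact Finset.sum_congr rfl fun g _ => by simp

variable {α : Type*} [Fintype α] [DecidableEq α]

/-- In a doubly transitive group, the number of elements with two prescribed values does not depend
on these values, and it determines the number of elements with one prescribed value. -/
theorem exists_card_filter_of_two_transitive (G : Subgroup (Equiv.Perm α))
    (h2 : ∀ a b c d : α, a ≠ b → c ≠ d → ∃ g ∈ G, g a = c ∧ g b = d) (hα : 1 < Fintype.card α)
    (S : Finset (Equiv.Perm α)) (hS : ∀ g, g ∈ S ↔ g ∈ G) :
    ∃ N : ℕ, 0 < N ∧
      (∀ a b c d : α, a ≠ b → c ≠ d →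
        (S.filter fun g => (g a, g b) = (c, d)).card = N) ∧
      ∀ a c : α, (S.filter fun g => g a = c).card = (Fintype.card α - 1) * N := by
  obtain ⟨a₀, b₀, hab₀⟩ := Fintype.one_lt_card_iff.1 hα
  have key : ∀ a b c d : α, a ≠ b → c ≠ d →
      (S.filter fun g => (g a, g b) = (c, d)).card =
        (S.filter fun g => (g a₀, g b₀) = (a₀, b₀)).card := by
    intro a b c d hab hcd
    obtain ⟨k, hk, hka, hkb⟩ := h2 a₀ b₀ a b hab₀ hab
    obtain ⟨l, hl, hlc, hld⟩ := h2 a₀ b₀ c d hab₀ hcd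
    refine Finset.card_nbij' (fun g => l⁻¹ * g * k) (fun g => l * g * k⁻¹) ?_ ?_ ?_ ?_
    · intro g hg
      simp only [Finset.coe_filter, Set.mem_ofPred_eq, hS, Prod.mk.injEq] at hg ⊢
      refine ⟨G.mul_mem (G.mul_mem (G.inv_mem hl) hg.1) hk, ?_, ?_⟩
      · simp [hka, hg.2.1, ← hlc]
      · simp [hkb, hg.2.2, ← hld]
    · intro g hg
      simp only [Finset.coe_filter, Set.mem_ofPred_eq, hS, Prod.mk.injEq] at hg ⊢
      refine ⟨G.mul_mem (G.mul_mem hl hg.1) (G.inv_mem hk), ?_, ?_⟩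
      · simp [← hka, hg.2.1, hlc]
      · simp [← hkb, hg.2.2, hld]
    · intro g _
      simp [mul_assoc]
    · intro g _
      simp [mul_assoc]
  refine ⟨_, ?_, key, ?_⟩
  · exact Finset.card_pos.2 ⟨1, by simp [hS, G.one_mem]⟩
  · intro a c
    obtain ⟨b, hb⟩ := Fintype.exists_ne_of_one_lt_card hα a
    rw [Finset.card_eq_sum_card_fiberwise (f := fun g : Equiv.Perm α => g b)
      (t := Finset.univ.erase c)]
    · rw [Finset.sum_congr rfl (g := fun _ => (S.filter fun g => (g a₀, g b₀) = (a₀, b₀)).card)]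
      · simp
      · intro d hd
        rw [← key a b c d hb.symm (Finset.ne_of_mem_erase hd).symm, Finset.filter_filter]
        simp only [Prod.mk.injEq]
    · intro g hg
      simp only [Finset.coe_filter, Set.mem_ofPred_eq] at hg
      simp only [Finset.coe_erase, Finset.coe_univ, Set.mem_sdiff, Set.mem_univ, true_and,
        Set.mem_singleton_iff]
      rw [← hg.2]
      exact fun h => hb (g.injective h)

/-- Averages, over a doubly transitive group, of the size of the intersection of the support of `t`
with a translate, of its number of ordered pairs of distinct elements, and of the number of its
points at which `t` and its conjugate agree. -/
theorem exists_sum_card_of_two_transitive (G : Subgroup (Equiv.Perm α))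
    (h2 : ∀ a b c d : α, a ≠ b → c ≠ d → ∃ g ∈ G, g a = c ∧ g b = d) (hα : 1 < Fintype.card α)
    (S : Finset (Equiv.Perm α)) (hS : ∀ g, g ∈ S ↔ g ∈ G) (t : Equiv.Perm α) :
    ∃ N : ℕ, 0 < N ∧
      ∑ g ∈ S, (t.support.filter fun a => g a ∈ t.support).card =
        t.support.card ^ 2 * (Fintype.card α - 1) * N ∧
      ∑ g ∈ S, (t.support.filter fun a => g a ∈ t.support).offDiag.card =
        t.support.offDiag.card ^ 2 * N ∧
      ∑ g ∈ S, (t.support.filter fun a => g a ∈ t.support ∧ g (t a) = t (g a)).card =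
        t.support.card ^ 2 * N := by
  obtain ⟨N, hN, hN2, hN1⟩ := exists_card_filter_of_two_transitive G h2 hα S hS
  refine ⟨N, hN, ?_, ?_, ?_⟩
  · rw [sum_card_filter_apply_mem S t.support t.support fun g a => g a]
    simp only [hN1, Finset.sum_const, smul_eq_mul]
    ring
  · have h1 : ∀ g : Equiv.Perm α, (t.support.filter fun a => g a ∈ t.support).offDiag =
        t.support.offDiag.filter fun q => (g q.1, g q.2) ∈ t.support.offDiag := by
      intro g
      ext q
      simp only [Finset.mem_offDiag, Finset.mem_filter, ne_eq, g.injective.eq_iff]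
      tauto
    simp only [h1]
    rw [sum_card_filter_apply_mem S t.support.offDiag t.support.offDiag
      fun g q => (g q.1, g q.2)]
    rw [Finset.sum_congr rfl (g := fun _ => t.support.offDiag.card * N)]
    · simp only [Finset.sum_const, smul_eq_mul]
      ring
    · intro q hq
      rw [Finset.sum_congr rfl (g := fun _ => N)]
      · simp
      · intro q' hq'
        exact hN2 _ _ _ _ (Finset.mem_offDiag.1 hq).2.2 (Finset.mem_offDiag.1 hq').2.2
  · have hinj : Function.Injective fun c => (c, t c) := fun a b h => (Prod.ext_iff.1 h).1
    have h1 : ∀ g : Equiv.Perm α,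
        (t.support.filter fun a => g a ∈ t.support ∧ g (t a) = t (g a)) =
          t.support.filter fun a => (g a, g (t a)) ∈ t.support.image fun c => (c, t c) := by
      intro g
      ext a
      simp only [Finset.mem_filter, Finset.mem_image, Prod.mk.injEq]
      constructor
      · rintro ⟨ha, hga, h⟩
        exact ⟨ha, _, hga, rfl, h.symm⟩
      · rintro ⟨ha, c, hc, rfl, h⟩
        exact ⟨ha, hc, h.symm⟩
    simp only [h1]
    rw [sum_card_filter_apply_mem S t.support (t.support.image fun c => (c, t c))
      fun g a => (g a, g (t a))]
    rw [Finset.sum_congr rfl (g := fun _ => t.support.card * N)]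
    · simp only [Finset.sum_const, smul_eq_mul]
      ring
    · intro a ha
      rw [Finset.sum_image hinj.injOn, Finset.sum_congr rfl (g := fun _ => N)]
      · simp
      · intro c hc
        exact hN2 _ _ _ _ (Equiv.Perm.mem_support.1 ha).symm (Equiv.Perm.mem_support.1 hc).symm

/-- A doubly transitive group contains an element moving the support of a given permutation of small
support to a set that meets it in exactly one point. -/
theorem exists_card_support_inter_eq_one (G : Subgroup (Equiv.Perm α))
    (h2 : ∀ a b c d : α, a ≠ b → c ≠ d → ∃ g ∈ G, g a = c ∧ g b = d) (t : Equiv.Perm α)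
    (ht : 0 < t.support.card) (hcard : (t.support.card - 1) ^ 2 + 1 < Fintype.card α) :
    ∃ g ∈ G, (t.support.filter fun a => g a ∈ t.support).card = 1 := by
  classical
  let S : Finset (Equiv.Perm α) := Finset.univ.filter (· ∈ G)
  have hS : ∀ g, g ∈ S ↔ g ∈ G := by simp [S]
  obtain ⟨N, hN, h1, hoff, -⟩ := exists_sum_card_of_two_transitive G h2 (by omega) S hS t
  by_contra! H
  have hle : ∑ g ∈ S, (t.support.filter fun a => g a ∈ t.support).card ≤
      ∑ g ∈ S, (t.support.filter fun a => g a ∈ t.support).offDiag.card := by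
    refine Finset.sum_le_sum fun g hg => ?_
    rw [Finset.offDiag_card]
    have := H g ((hS g).1 hg)
    generalize (t.support.filter fun a => g a ∈ t.support).card = x at *
    rcases x with _ | _ | x
    · simp
    · omega
    · have : (x + 2) * (x + 2) = (x + 2) + (x + 2) * (x + 1) := by ring
      rw [this, Nat.add_sub_cancel_left]
      nlinarith
  rw [h1, hoff, Finset.offDiag_card] at hle
  obtain ⟨m, hm⟩ : ∃ m, t.support.card = m + 1 := ⟨t.support.card - 1, by omega⟩
  obtain ⟨n, hn⟩ : ∃ n, Fintype.card α = n + 1 := ⟨Fintype.card α - 1, by omega⟩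
  have h3 : (m + 1) * (m + 1) - (m + 1) = (m + 1) * m := by
    rw [Nat.sub_eq_iff_eq_add] <;> nlinarith
  rw [hm, hn, h3] at hle
  rw [hm, hn] at hcard
  simp only [Nat.add_sub_cancel] at hle hcard
  have h4 := Nat.le_of_mul_le_mul_right hle hN
  rw [mul_pow] at h4
  have := Nat.le_of_mul_le_mul_left h4 (by positivity)
  omega

/-- A doubly transitive group contains an element moving the support of a given permutation `t` of
small support to a set that meets it in one point, or in two points where `t` and its conjugate do
not agree. -/
theorem exists_card_support_inter_le_two (G : Subgroup (Equiv.Perm α))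
    (h2 : ∀ a b c d : α, a ≠ b → c ≠ d → ∃ g ∈ G, g a = c ∧ g b = d) (t : Equiv.Perm α)
    (ht : 0 < t.support.card) (hcard : (t.support.card - 1) ^ 2 + 3 < 2 * Fintype.card α) :
    ∃ g ∈ G, (t.support.filter fun a => g a ∈ t.support).card = 1 ∨
      (t.support.filter fun a => g a ∈ t.support).card = 2 ∧
      (t.support.filter fun a => g a ∈ t.support ∧ g (t a) = t (g a)).card < 2 := by
  classical
  let S : Finset (Equiv.Perm α) := Finset.univ.filter (· ∈ G)
  have hS : ∀ g, g ∈ S ↔ g ∈ G := by simp [S]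
  obtain ⟨N, hN, h1, hoff, hC⟩ := exists_sum_card_of_two_transitive G h2 (by omega) S hS t
  by_contra! H
  have hle : ∑ g ∈ S, 2 * (t.support.filter fun a => g a ∈ t.support).card ≤
      ∑ g ∈ S, ((t.support.filter fun a => g a ∈ t.support).offDiag.card +
        (t.support.filter fun a => g a ∈ t.support ∧ g (t a) = t (g a)).card) := by
    refine Finset.sum_le_sum fun g hg => ?_
    rw [Finset.offDiag_card]
    have := H g ((hS g).1 hg)
    generalize (t.support.filter fun a => g a ∈ t.support).card = x at *
    rcases x with _ | _ | _ | x
    · simp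
    · omega
    · simp at this ⊢
      omega
    · have : (x + 3) * (x + 3) = (x + 3) + (x + 3) * (x + 2) := by ring
      simp only [add_assoc, Nat.reduceAdd]
      rw [this, Nat.add_sub_cancel_left]
      nlinarith
  rw [← Finset.mul_sum, Finset.sum_add_distrib, h1, hoff, hC, Finset.offDiag_card] at hle
  obtain ⟨m, hm⟩ : ∃ m, t.support.card = m + 1 := ⟨t.support.card - 1, by omega⟩
  obtain ⟨n, hn⟩ : ∃ n, Fintype.card α = n + 1 := ⟨Fintype.card α - 1, by omega⟩
  have h3 : (m + 1) * (m + 1) - (m + 1) = (m + 1) * m := by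
    rw [Nat.sub_eq_iff_eq_add] <;> nlinarith
  rw [hm, hn, h3] at hle
  rw [hm, hn] at hcard
  simp only [Nat.add_sub_cancel] at hle hcard
  have h4 : (m + 1) ^ 2 * N * (2 * n) ≤ (m + 1) ^ 2 * N * (m ^ 2 + 1) := by
    calc _ = 2 * ((m + 1) ^ 2 * n * N) := by ring
      _ ≤ _ := hle
      _ = _ := by ring
  have := Nat.le_of_mul_le_mul_left h4 (by positivity)
  omega

end Counting

section Commutator

open Equiv.Perm

variable {α : Type*} [Fintype α] [DecidableEq α]

/-- The support of a commutator is at most three times the intersection of the supports. -/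
theorem card_support_commutator_le (s t : Equiv.Perm α) :
    (t * s * t⁻¹ * s⁻¹).support.card ≤ 3 * (t.support ∩ s.support).card := by
  set K := t.support ∩ s.support with hK
  have hsub : (t * s * t⁻¹ * s⁻¹).support ⊆ K ∪ (K.image t ∪ K.image s) := by
    intro x hx
    by_contra hxn
    simp only [Finset.mem_union, not_or] at hxn
    obtain ⟨hxK, hxt, hxs⟩ := hxn
    have htK : t⁻¹ x ∉ K := fun h => hxt (Finset.mem_image.2 ⟨_, h, by simp⟩)
    have hsK : s⁻¹ x ∉ K := fun h => hxs (Finset.mem_image.2 ⟨_, h, by simp⟩)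
    have key : t⁻¹ (s⁻¹ x) = s⁻¹ (t⁻¹ x) := by
      by_cases h1 : x ∈ t.support <;> by_cases h2 : x ∈ s.support
      · exact absurd (Finset.mem_inter.2 ⟨h1, h2⟩) hxK
      · have h3 : t⁻¹ x ∈ t.support := by
          rw [← support_inv] at h1 ⊢
          exact apply_mem_support.2 h1
        have h4 : t⁻¹ x ∉ s.support := fun h => htK (Finset.mem_inter.2 ⟨h3, h⟩)
        rw [← support_inv, notMem_support] at h2 h4
        rw [h2, h4]
      · have h3 : s⁻¹ x ∈ s.support := by
          rw [← support_inv] at h2 ⊢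
          exact apply_mem_support.2 h2
        have h4 : s⁻¹ x ∉ t.support := fun h => hsK (Finset.mem_inter.2 ⟨h, h3⟩)
        rw [← support_inv, notMem_support] at h1 h4
        rw [h1, h4]
      · rw [← support_inv, notMem_support] at h1 h2
        rw [h1, h2, h1]
    apply mem_support.1 hx
    rw [mul_apply, mul_apply, mul_apply, key]
    simp
  calc _ ≤ _ := Finset.card_le_card hsub
    _ ≤ K.card + (K.card + K.card) := (Finset.card_union_le _ _).trans
      (Nat.add_le_add_left ((Finset.card_union_le _ _).trans
        (Nat.add_le_add Finset.card_image_le Finset.card_image_le)) _)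
    _ = _ := by ring

/-- The supports of `t` and of its conjugate by `g` meet in as many points as `g` maps from the
support of `t` into itself. -/
theorem card_support_inter_support_conj (g t : Equiv.Perm α) :
    (t.support ∩ (g * t * g⁻¹).support).card =
      (t.support.filter fun a => g a ∈ t.support).card := by
  rw [← Finset.card_image_of_injective (t.support.filter fun a => g a ∈ t.support) g.injective]
  congr 1
  ext x
  simp only [Finset.mem_inter, Finset.mem_image, Finset.mem_filter]
  constructor
  · rintro ⟨h1, h2⟩
    rw [mem_support] at h2
    refine ⟨g⁻¹ x, ⟨mem_support.2 fun h => h2 ?_, by simpa using h1⟩, by simp⟩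
    rw [mul_apply, mul_apply, h]
    simp
  · rintro ⟨a, ⟨h1, h2⟩, rfl⟩
    exact ⟨h2, by simpa using h1⟩

/-- If the supports of `t` and of its conjugate by `g` meet in one point, or in two points where
they do not agree, then `t` does not commute with its conjugate. -/
theorem commutator_conj_ne_one (g t : Equiv.Perm α)
    (h : (t.support.filter fun a => g a ∈ t.support).card = 1 ∨
      (t.support.filter fun a => g a ∈ t.support).card = 2 ∧
      (t.support.filter fun a => g a ∈ t.support ∧ g (t a) = t (g a)).card < 2) :
    t * (g * t * g⁻¹) * t⁻¹ * (g * t * g⁻¹)⁻¹ ≠ 1 := by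
  intro hc
  set s := g * t * g⁻¹ with hs
  have hcomm : t * s = s * t := by
    rw [mul_inv_eq_one, mul_inv_eq_iff_eq_mul] at hc
    exact hc
  have hcomm' : ∀ x, t (s x) = s (t x) := fun x => congrArg (fun π : Equiv.Perm α => π x) hcomm
  have hK := card_support_inter_support_conj g t
  rw [← hs] at hK
  have htK : ∀ x ∈ t.support ∩ s.support, t x ∈ t.support ∩ s.support := by
    intro x hx
    rw [Finset.mem_inter] at hx ⊢
    refine ⟨apply_mem_support.2 hx.1, ?_⟩
    rw [mem_support, ← hcomm', t.injective.ne_iff]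
    exact mem_support.1 hx.2
  have hsK : ∀ x ∈ t.support ∩ s.support, s x ∈ t.support ∩ s.support := by
    intro x hx
    rw [Finset.mem_inter] at hx ⊢
    refine ⟨?_, apply_mem_support.2 hx.2⟩
    rw [mem_support, hcomm', s.injective.ne_iff]
    exact mem_support.1 hx.1
  have ht : ∀ x ∈ t.support ∩ s.support, t x ≠ x := fun x hx =>
    mem_support.1 (Finset.mem_inter.1 hx).1
  have hs' : ∀ x ∈ t.support ∩ s.support, s x ≠ x := fun x hx =>
    mem_support.1 (Finset.mem_inter.1 hx).2
  rcases h with h | ⟨h, h'⟩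
  · rw [← hK, Finset.card_eq_one] at h
    obtain ⟨a, ha⟩ := h
    simp only [ha, Finset.mem_singleton, forall_eq] at htK ht
    exact ht htK
  · refine absurd h' (not_lt.2 (h.symm.le.trans (Finset.card_le_card ?_)))
    have hagree : ∀ x ∈ t.support ∩ s.support, s x = t x := by
      rw [← hK, Finset.card_eq_two] at h
      obtain ⟨a, b, -, hab⟩ := h
      intro x hx
      have h1 := htK x hx
      have h2 := hsK x hx
      have h3 := ht x hx
      have h4 := hs' x hx
      rw [hab, Finset.mem_insert, Finset.mem_singleton] at h1 h2 hx
      grind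
    intro a ha
    rw [Finset.mem_filter] at ha ⊢
    refine ⟨ha.1, ha.2, ?_⟩
    rw [← hagree (g a) (Finset.mem_inter.2 ⟨ha.2, ?_⟩)]
    · simp [hs]
    · simpa [hs] using ha.1

end Commutator

section PrimeDegree

open Equiv.Perm

variable {α : Type*} [Fintype α] [DecidableEq α]

/-- A permutation group of prime degree `p` and order divisible by `p` which contains a nontrivial
permutation fixing about half of the points is doubly transitive. -/
theorem two_transitive_of_card_support_le {p : ℕ} (hp : p.Prime) (hα : Fintype.card α = p)
    (G : Subgroup (Equiv.Perm α)) (hG : p ∣ Nat.card G) (t : Equiv.Perm α) (ht : t ∈ G)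
    (ht1 : t ≠ 1) (hsupp : 2 * t.support.card ≤ p + 1) (a b c d : α) (hab : a ≠ b) (hcd : c ≠ d) :
    ∃ g ∈ G, g a = c ∧ g b = d := by
  classical
  have : Fact p.Prime := ⟨hp⟩
  obtain ⟨⟨σ, hσG⟩, hσ⟩ := exists_prime_orderOf_dvd_card' p hG
  rw [Subgroup.orderOf_mk] at hσ
  have hσp : σ ^ p = 1 := hσ ▸ pow_orderOf_eq_one σ
  have hcyc : σ.IsCycle := isCycle_of_prime_order'' (hα ▸ hp) (hσ.trans hα.symm)
  have hmov : ∀ x, σ x ≠ x := by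
    intro x
    have h1 : σ.support = Finset.univ := by
      rw [← Finset.card_eq_iff_eq_univ, ← hcyc.orderOf, hσ, hα]
    exact mem_support.1 (h1 ▸ Finset.mem_univ x)
  have hpow : ∀ n : ℕ, σ ^ (n % p) = σ ^ n := fun n => by rw [← hσ, pow_mod_orderOf]
  let e₀ : ZMod p → α := fun k => (σ ^ k.val) a
  have he₀ : Function.Bijective e₀ := by
    rw [Fintype.bijective_iff_surjective_and_card, ZMod.card, hα]
    refine ⟨fun y => ?_, rfl⟩
    obtain ⟨i, hi⟩ := hcyc.exists_pow_eq (hmov a) (hmov y)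
    exact ⟨i, by simp only [e₀, ZMod.val_natCast, hpow, hi]⟩
  let e : ZMod p ≃ α := Equiv.ofBijective e₀ he₀
  have he : ∀ k j, e (k + j) = (σ ^ j.val) (e k) := by
    intro k j
    change (σ ^ (k + j).val) a = (σ ^ j.val) ((σ ^ k.val) a)
    rw [ZMod.val_add, hpow, add_comm, pow_add, mul_apply]
  let R : α → α → Prop := fun x y => ∃ g ∈ G, g a = x ∧ g b = y
  have hR1 : ∀ g ∈ G, ∀ x y, R x y → R (g x) (g y) := by
    rintro g hg x y ⟨k, hk, rfl, rfl⟩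
    exact ⟨g * k, G.mul_mem hg hk, rfl, rfl⟩
  have hR : ∀ g ∈ G, ∀ x y, R (g x) (g y) ↔ R x y := by
    refine fun g hg x y => ⟨fun h => ?_, hR1 g hg x y⟩
    simpa using hR1 g⁻¹ (G.inv_mem hg) _ _ h
  let U : Finset (ZMod p) := Finset.univ.filter fun u => R (e 0) (e u)
  have hU : ∀ x y, y - x ∈ U ↔ R (e x) (e y) := by
    intro x y
    have h1 := he 0 x
    have h2 := he (y - x) x
    rw [zero_add] at h1
    rw [sub_add_cancel] at h2
    rw [h1, h2, hR _ (G.pow_mem hσG _)]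
    simp [U]
  by_contra hcon
  let π : Equiv.Perm (ZMod p) := (e.trans t).trans e.symm
  have hπ : ∀ x, e (π x) = t (e x) := fun x => by simp [π]
  have hπ1 : π = 1 := by
    refine perm_eq_one_of_preserves_differences U ?_ ⟨e.symm b - e.symm a, ?_⟩
      ⟨e.symm d - e.symm c, ?_, ?_⟩ π ?_ ?_
    · intro h
      rw [← sub_self (0 : ZMod p), hU] at h
      obtain ⟨g, -, h1, h2⟩ := h
      exact hab (g.injective (h1.trans h2.symm))
    · rw [hU]
      exact ⟨1, G.one_mem, by simp⟩
    · rw [sub_ne_zero]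
      exact fun h => hcd (e.symm.injective h).symm
    · rw [hU, e.apply_symm_apply, e.apply_symm_apply]
      exact hcon
    · intro x y
      rw [hU, hU, hπ, hπ, hR t ht]
    · suffices π.support.card = t.support.card by rwa [this]
      refine Finset.card_bij (fun x _ => e x) ?_ (fun x _ y _ h => e.injective h) ?_
      · intro x hx
        rw [mem_support] at hx ⊢
        rw [← hπ]
        exact fun h => hx (e.injective h)
      · intro y hy
        refine ⟨e.symm y, ?_, by simp⟩
        rw [mem_support] at hy ⊢
        intro h
        have := hπ (e.symm y)
        rw [h, e.apply_symm_apply] at this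
        exact hy this.symm
  refine ht1 (Equiv.ext fun y => ?_)
  have := hπ (e.symm y)
  rw [hπ1, one_apply, e.apply_symm_apply] at this
  exact this.symm

/-- A permutation group of prime degree `p > 23` and order divisible by `p` which contains a
permutation moving exactly eight points contains the alternating group. -/
theorem alternatingGroup_le_of_card_support_eq_eight {p : ℕ} (hp : p.Prime) (hp23 : 23 < p)
    (hα : Fintype.card α = p) (G : Subgroup (Equiv.Perm α)) (hG : p ∣ Nat.card G)
    (t : Equiv.Perm α) (ht : t ∈ G) (hsupp : t.support.card = 8) : alternatingGroup α ≤ G := by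
  have hp26 : 26 < p := by
    by_contra! h
    interval_cases p <;> revert hp <;> norm_num
  have h2 := two_transitive_of_card_support_le hp hα G hG t ht (by rintro rfl; simp at hsupp)
    (by omega)
  have hcomm : ∀ x ∈ G, ∀ g ∈ G, x * (g * x * g⁻¹) * x⁻¹ * (g * x * g⁻¹)⁻¹ ∈ G := by
    intro x hx g hg
    have hs : g * x * g⁻¹ ∈ G := G.mul_mem (G.mul_mem hg hx) (G.inv_mem hg)
    exact G.mul_mem (G.mul_mem (G.mul_mem hx hs) (G.inv_mem hx)) (G.inv_mem hs)
  obtain ⟨x, hx, hx1, hx6⟩ : ∃ x ∈ G, x ≠ 1 ∧ x.support.card ≤ 6 := by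
    obtain ⟨g, hg, h⟩ := exists_card_support_inter_le_two G h2 t (by omega)
      (by rw [hsupp]; omega)
    refine ⟨_, hcomm t ht g hg, commutator_conj_ne_one g t h,
      (card_support_commutator_le _ _).trans ?_⟩
    rw [card_support_inter_support_conj]
    omega
  obtain ⟨y, hy, hy1, hy3⟩ : ∃ y ∈ G, y ≠ 1 ∧ y.support.card ≤ 3 := by
    obtain ⟨g, hg, h⟩ := exists_card_support_inter_eq_one G h2 x
      (Nat.pos_of_ne_zero fun h => hx1 (card_support_eq_zero.1 h)) (by
        have : (x.support.card - 1) ^ 2 ≤ 5 ^ 2 := Nat.pow_le_pow_left (by omega) 2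
        omega)
    refine ⟨_, hcomm x hx g hg, commutator_conj_ne_one g x (Or.inl h),
      (card_support_commutator_le _ _).trans ?_⟩
    rw [card_support_inter_support_conj]
    omega
  have hprim : MulAction.IsPreprimitive G α := by
    refine MulAction.isPreprimitive_of_is_two_pretransitive
      (MulAction.is_two_pretransitive_iff.2 fun {a b c d} hab hcd => ?_)
    obtain ⟨g, hg, h⟩ := h2 a b c d hab hcd
    exact ⟨⟨g, hg⟩, h⟩
  have hy0 : 1 < y.support.card := by
    by_contra! h
    exact hy1 (card_support_le_one.1 h)
  obtain h | h : y.support.card = 2 ∨ y.support.card = 3 := by omega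
  · rw [subgroup_eq_top_of_isPreprimitive_of_isSwap_mem hprim y (card_support_eq_two.1 h) hy]
    exact le_top
  · exact alternatingGroup_le_of_isPreprimitive_of_isThreeCycle_mem hprim
      (card_support_eq_three_iff.1 h) hy

/-- A permutation group containing the alternating group is the alternating or the symmetric
group. -/
theorem eq_alternatingGroup_or_eq_top [Nontrivial α] {G : Subgroup (Equiv.Perm α)}
    (h : alternatingGroup α ≤ G) : G = alternatingGroup α ∨ G = ⊤ := by
  have h1 := Subgroup.index_dvd_of_le h
  rw [alternatingGroup.index_eq_two, Nat.dvd_prime Nat.prime_two, Subgroup.index_eq_one] at h1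
  exact h1.symm.imp_left eq_alternatingGroup_of_index_eq_two

end PrimeDegree

section Galois

attribute [local instance] Polynomial.Gal.splits_ℚ_ℂ

open Polynomial.Gal in
/-- Complex conjugation, as a permutation of the complex roots, moves exactly the non-real roots. -/
theorem card_support_galActionHom_conj (f : ℚ[X]) (hf : f ≠ 0) :
    (galActionHom f ℂ (restrict f ℂ
      (AlgEquiv.restrictScalars ℚ Complex.conjAe))).support.card =
      {z : ℂ | aeval z f = 0 ∧ z.im ≠ 0}.ncard := by
  rw [← Set.ncard_coe_finset, ← Set.ncard_image_of_injective _ Subtype.val_injective]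
  congr 1
  have hfix : ∀ w : f.rootSet ℂ,
      galActionHom f ℂ (restrict f ℂ (Complex.conjAe.restrictScalars ℚ)) w = w ↔
        w.val.im = 0 := by
    intro w
    rw [Subtype.ext_iff, galActionHom_restrict]
    exact Complex.conj_eq_iff_im
  ext z
  constructor
  · rintro ⟨w, hw, rfl⟩
    exact ⟨(mem_rootSet.1 w.2).2, fun h => Equiv.Perm.mem_support.1 hw ((hfix w).2 h)⟩
  · rintro ⟨h1, h2⟩
    exact ⟨⟨z, mem_rootSet.2 ⟨hf, h1⟩⟩,
      Equiv.Perm.mem_support.2 fun h => h2 ((hfix _).1 h), rfl⟩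

/-- If an irreducible polynomial over ℚ of prime degree p > 23 has exactly 8 non-real
complex roots, then its Galois group is A_p or S_p. -/
theorem galois_group_eq_alternating_or_symmetric_of_8_nonreal_roots
    (f : ℚ[X]) (p : ℕ) (hp : p.Prime) (hpgt : 23 < p)
    (hdeg : f.natDegree = p) (hirr : Irreducible f)
    (hroots : {z : ℂ | aeval z f = 0 ∧ z.im ≠ 0}.ncard = 8) :
    Nonempty (f.Gal ≃* alternatingGroup (Fin p)) ∨
      Nonempty (f.Gal ≃* Equiv.Perm (Fin p)) := by
  have hcard : Fintype.card (f.rootSet ℂ) = p := by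
    rw [← hdeg]
    exact card_rootSet_eq_natDegree hirr.separable (IsAlgClosed.splits _)
  let φ := Polynomial.Gal.galActionHom f ℂ
  let ψ : f.Gal ≃* φ.range := MonoidHom.ofInjective (Polynomial.Gal.galActionHom_injective f ℂ)
  have hdvd : p ∣ Nat.card φ.range := by
    rw [← Nat.card_congr ψ.toEquiv, ← hdeg]
    exact Polynomial.Gal.prime_degree_dvd_card hirr (hdeg ▸ hp)
  have hle : alternatingGroup (f.rootSet ℂ) ≤ φ.range :=
    alternatingGroup_le_of_card_support_eq_eight hp hpgt hcard φ.range hdvd _ ⟨_, rfl⟩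
      ((card_support_galActionHom_conj f hirr.ne_zero).trans hroots)
  have : Nontrivial (f.rootSet ℂ) := Fintype.one_lt_card_iff_nontrivial.1 (by omega)
  let e : f.rootSet ℂ ≃ Fin p := Fintype.equivFinOfCardEq hcard
  rcases eq_alternatingGroup_or_eq_top hle with h | h
  · exact Or.inl ⟨(ψ.trans (MulEquiv.subgroupCongr h)).trans e.altCongrHom⟩
  · exact Or.inr ⟨((ψ.trans (MulEquiv.subgroupCongr h)).trans Subgroup.topEquiv).trans
      e.permCongrHom⟩

end Galois
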